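/- Let C be a Minkowski-centered full-dimensional convex body in R^n with 0 in its interior. Then C_MAX = conv(C ∪ (−C)) is a completion of C with respect to the maximum diameter D_MAX, and among all completions of C it has maximal circumradius R(C_MAX, C) = s(C). -/

import Mathlib

open Pointwise Set

variable {V : Type*} [NormedAddCommGroup V] [NormedSpace ℝ V]

/-- Circumradius `R(K,C) = inf {ρ ≥ 0 : ∃ t, K ⊆ t + ρC}`. -/
noncomputable def circumradius (K C : Set V) : ℝ :=
  sInf {ρ : ℝ | 0 ≤ ρ ∧ ∃ t : V, K ⊆ t +ᵥ ρ • C}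

/-- Inradius `r(K,C) = sup {ρ ≥ 0 : ∃ t, t + ρC ⊆ K}`. -/
noncomputable def inradius (K C : Set V) : ℝ :=
  sSup {ρ : ℝ | 0 ≤ ρ ∧ ∃ t : V, t +ᵥ ρ • C ⊆ K}

/-- Optimal containment: `K ⊆ C` and `R(K,C) = 1`. -/
def OptCont (K C : Set V) : Prop := K ⊆ C ∧ circumradius K C = 1

/-- Minkowski asymmetry `s(C) = R(C, -C)`. -/
noncomputable def minkAsym (C : Set V) : ℝ := circumradius C (-C)

/-- `C` is Minkowski-centered if `C ⊆opt s(C) • (-C)`. -/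
def MinkowskiCentered (C : Set V) : Prop := OptCont C (minkAsym C • (-C))

/-- Arithmetic symmetrization `(K - K)/2`. -/
def symAM (K : Set V) : Set V := (2 : ℝ)⁻¹ • (K - K)

/-- Maximum symmetrization `conv (C ∪ -C)`. -/
def symMAX (C : Set V) : Set V := convexHull ℝ (C ∪ -C)

/-- Minimum symmetrization `C ∩ -C`. -/
def symMIN (C : Set V) : Set V := C ∩ -C

/-- The maximum diameter `D_MAX(K,C) = 2 R((K-K)/2, conv(C ∪ -C))`. -/
noncomputable def DMAX (K C : Set V) : ℝ := 2 * circumradius (symAM K) (symMAX C)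

/-- The minimum diameter `D_MIN(K,C) = 2 R((K-K)/2, C ∩ -C)`. -/
noncomputable def DMIN (K C : Set V) : ℝ := 2 * circumradius (symAM K) (symMIN C)

/-- A body is complete (w.r.t. a diameter functional `D`) if every strictly larger
convex body has strictly larger diameter. -/
def IsCompleteBody (D : Set V → ℝ) (K : Set V) : Prop :=
  ∀ K' : Set V, Convex ℝ K' → IsCompact K' → K ⊂ K' → D K < D K'

/-- `Kstar` is a completion of `K` w.r.t. the diameter functional `D`. -/
def IsCompletion (D : Set V → ℝ) (K Kstar : Set V) : Prop :=
  K ⊆ Kstar ∧ Convex ℝ Kstar ∧ IsCompact Kstar ∧ IsCompleteBody D Kstar ∧ D Kstar = D K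

section helpers

variable {E : Type*} [NormedAddCommGroup E] [NormedSpace ℝ E]

theorem hlp_bddBelow (K C : Set E) :
    BddBelow {ρ : ℝ | 0 ≤ ρ ∧ ∃ t : E, K ⊆ t +ᵥ ρ • C} := ⟨0, fun _ h => h.1⟩

theorem hlp_circ_le {K C : Set E} {ρ : ℝ} (hρ : 0 ≤ ρ) (t : E) (h : K ⊆ t +ᵥ ρ • C) :
    circumradius K C ≤ ρ := csInf_le (hlp_bddBelow K C) ⟨hρ, t, h⟩

theorem hlp_circ_nonneg (K C : Set E) : 0 ≤ circumradius K C :=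
  Real.sInf_nonneg (fun _ h => h.1)

theorem hlp_absorb {K C : Set E} (hK : IsCompact K) (h0 : 0 ∈ interior C) :
    ∃ ρ : ℝ, 0 ≤ ρ ∧ ∃ t : E, K ⊆ t +ᵥ ρ • C := by
  have h1 : Absorbs ℝ C K := hK.isVonNBounded (𝕜 := ℝ) (mem_interior_iff_mem_nhds.1 h0)
  obtain ⟨r, hr, h⟩ := h1.exists_pos
  refine ⟨r, hr.le, 0, ?_⟩
  rw [zero_vadd]
  exact h r (by rw [Real.norm_eq_abs]; exact le_abs_self r)

theorem hlp_symAM_compact {K : Set E} (hK : IsCompact K) : IsCompact (symAM K) := by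
  unfold symAM
  have h : IsCompact (K - K) := by
    rw [sub_eq_add_neg]
    exact hK.add hK.neg
  exact h.smul _

theorem hlp_sub_symMAX (C : Set E) : C ⊆ symMAX C :=
  subset_union_left.trans (subset_convexHull ℝ _)

theorem hlp_neg_sub_symMAX (C : Set E) : -C ⊆ symMAX C :=
  subset_union_right.trans (subset_convexHull ℝ _)

theorem hlp_symMAX_convex (C : Set E) : Convex ℝ (symMAX C) := convex_convexHull ℝ _

theorem hlp_symMAX_neg (C : Set E) {x : E} (hx : x ∈ symMAX C) : -x ∈ symMAX C := by
  have h : symMAX C ⊆ -symMAX C := by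
    apply convexHull_min
    · rintro y (hy | hy)
      · exact hlp_neg_sub_symMAX C (by simpa using hy)
      · exact hlp_sub_symMAX C hy
    · exact (hlp_symMAX_convex C).neg
  exact h hx

theorem hlp_symMAX_compact {C : Set E} (hC : Convex ℝ C) (hc : IsCompact C) (h0 : (0 : E) ∈ C) :
    IsCompact (symMAX C) := by
  have h1 : symMAX C = (fun p : ℝ × E × E => (1 - p.1) • p.2.1 + p.1 • p.2.2) ''
      (Icc (0 : ℝ) 1 ×ˢ C ×ˢ (-C)) := by
    unfold symMAX
    rw [hC.convexHull_union hC.neg ⟨0, h0⟩ ⟨0, by simpa using h0⟩]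
    ext x
    simp only [mem_convexJoin, segment_eq_image, mem_image, mem_prod, Prod.exists]
    constructor
    · rintro ⟨a, ha, b, hb, θ, hθ, rfl⟩
      exact ⟨θ, a, b, ⟨hθ, ha, hb⟩, rfl⟩
    · rintro ⟨θ, a, b, ⟨hθ, ha, hb⟩, rfl⟩
      exact ⟨a, ha, b, hb, θ, hθ, rfl⟩
  rw [h1]
  exact (isCompact_Icc.prod (hc.prod hc.neg)).image (by fun_prop)

theorem hlp_symMAX_bound {C : Set E} (f : StrongDual ℝ E) {m : ℝ}
    (h : ∀ z ∈ C, |f z| ≤ m) {z : E} (hz : z ∈ symMAX C) : |f z| ≤ m := by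
  have h1 : ∀ z ∈ symMAX C, f z ≤ m := by
    have : symMAX C ⊆ {z | f z ≤ m} := by
      apply convexHull_min
      · rintro y (hy | hy)
        · exact (abs_le.1 (h y hy)).2
        · have := (abs_le.1 (h (-y) hy)).1
          rw [map_neg] at this
          show f y ≤ m
          linarith
      · exact convex_halfSpace_le f.toLinearMap.isLinear m
    exact this
  have h2 := h1 _ (hlp_symMAX_neg C hz)
  rw [map_neg] at h2
  exact abs_le.2 ⟨by linarith, h1 z hz⟩

/-- Diameter lower bound. -/
theorem hlp_DMAX_ge {C K : Set E} (h0 : 0 ∈ interior C) (hK : IsCompact K)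
    (f : StrongDual ℝ E) {m : ℝ} (hm : 0 < m) (h : ∀ z ∈ C, |f z| ≤ m)
    {x y : E} (hx : x ∈ K) (hy : y ∈ K) : (f x - f y) / m ≤ DMAX K C := by
  have key : (f x - f y) / m / 2 ≤ circumradius (symAM K) (symMAX C) := by
    apply le_csInf
    · exact hlp_absorb (hlp_symAM_compact hK) (interior_mono (hlp_sub_symMAX C) h0)
    · rintro ρ ⟨hρ, t, ht⟩
      have a1 : (2 : ℝ)⁻¹ • (x - y) ∈ symAM K := smul_mem_smul_set (sub_mem_sub hx hy)
      have a2 : (2 : ℝ)⁻¹ • (y - x) ∈ symAM K := smul_mem_smul_set (sub_mem_sub hy hx)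
      obtain ⟨_, ⟨z, hz, rfl⟩, e1⟩ := ht a1
      obtain ⟨_, ⟨w, hw, rfl⟩, e2⟩ := ht a2
      have b1 := hlp_symMAX_bound f h hz
      have b2 := hlp_symMAX_bound f h hw
      have e1' := congrArg f e1
      have e2' := congrArg f e2
      simp only [vadd_eq_add, map_add, map_smul, map_sub, smul_eq_mul] at e1' e2'
      rw [div_div, div_le_iff₀ (by positivity)]
      have c1 := mul_le_mul_of_nonneg_left (abs_le.1 b1).2 hρ
      have c2 := mul_le_mul_of_nonneg_left (abs_le.1 b2).1 hρ
      linarith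
  unfold DMAX
  linarith

theorem hlp_DMAX_le {C K : Set E} (h : K ⊆ symMAX C) : DMAX K C ≤ 2 := by
  have : circumradius (symAM K) (symMAX C) ≤ 1 := by
    apply hlp_circ_le zero_le_one 0
    rw [zero_vadd, one_smul]
    rintro _ ⟨_, ⟨x, hx, y, hy, rfl⟩, rfl⟩
    have := hlp_symMAX_convex C (h hx) (hlp_symMAX_neg C (h hy))
      (by norm_num : (0 : ℝ) ≤ 2⁻¹) (by norm_num : (0 : ℝ) ≤ 2⁻¹) (by norm_num)
    convert this using 1
    simp only [smul_add, smul_neg, sub_eq_add_neg]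
  unfold DMAX
  linarith

theorem hlp_pos {C : Set E} (h0 : 0 ∈ interior C) (f : StrongDual ℝ E) {w : E} (hw : 0 < f w) :
    ∃ z ∈ C, 0 < f z := by
  have h1 : Filter.Tendsto (fun ε : ℝ => ε • w) (nhdsWithin 0 (Ioi 0)) (nhds 0) := by
    have : Continuous (fun ε : ℝ => ε • w) := by fun_prop
    have := this.tendsto 0
    rw [zero_smul] at this
    exact this.mono_left nhdsWithin_le_nhds
  have h2 := h1.eventually (mem_interior_iff_mem_nhds.1 h0)
  obtain ⟨ε, h3, h4⟩ := (h2.and self_mem_nhdsWithin).exists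
  refine ⟨ε • w, h3, ?_⟩
  rw [map_smul, smul_eq_mul]
  exact mul_pos h4 hw

/-- Balanced functional from equality of support values. -/
theorem hlp_bal_of {C : Set E} (h0 : 0 ∈ interior C) (f : StrongDual ℝ E) (hf : f ≠ 0)
    {x y : E} (hx : x ∈ C) (hy : y ∈ C) (hxm : ∀ z ∈ C, f z ≤ f x) (hym : ∀ z ∈ C, f y ≤ f z)
    (he : f x = -f y) :
    ∃ (f : StrongDual ℝ E) (m : ℝ), 0 < m ∧ (∀ z ∈ C, |f z| ≤ m) ∧
      ∃ x ∈ C, ∃ y ∈ C, f x = m ∧ f y = -m := by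
  refine ⟨f, f x, ?_, fun z hz => abs_le.2 ⟨?_, hxm z hz⟩, x, hx, y, hy, rfl, by linarith⟩
  · obtain ⟨w, hw⟩ : ∃ w, 0 < f w := by
      obtain ⟨w, hw⟩ : ∃ w, f w ≠ 0 := by
        by_contra! hcon
        exact hf (by ext w; simpa using hcon w)
      rcases lt_or_gt_of_ne hw with h | h
      · exact ⟨-w, by rw [map_neg]; linarith⟩
      · exact ⟨w, h⟩
    obtain ⟨z, hz, hz0⟩ := hlp_pos h0 f hw
    exact hz0.trans_le (hxm z hz)
  · have := hym z hz
    linarith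

end helpers

theorem hlp_bal {n : ℕ} (C : Set (EuclideanSpace ℝ (Fin n)))
    (hCconv : Convex ℝ C) (hCcomp : IsCompact C) (h0 : 0 ∈ interior C)
    (hMC : MinkowskiCentered C) :
    ∃ (f : StrongDual ℝ (EuclideanSpace ℝ (Fin n))) (m : ℝ), 0 < m ∧ (∀ z ∈ C, |f z| ≤ m) ∧
      ∃ x ∈ C, ∃ y ∈ C, f x = m ∧ f y = -m := by
  have h0C : (0 : EuclideanSpace ℝ (Fin n)) ∈ C := interior_subset h0
  have hne : C.Nonempty := ⟨0, h0C⟩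
  rcases Nat.lt_trichotomy n 1 with hn | hn | hn
  · exfalso
    obtain rfl : n = 0 := by omega
    have h1 : circumradius C (minkAsym C • (-C)) ≤ 0 := by
      apply hlp_circ_le le_rfl 0
      intro z _
      rw [zero_vadd]
      refine ⟨0, ⟨0, by simpa using h0C, by simp⟩, Subsingleton.elim _ _⟩
    rw [hMC.2] at h1
    linarith
  · subst hn
    let f : StrongDual ℝ (EuclideanSpace ℝ (Fin 1)) := EuclideanSpace.proj 0
    obtain ⟨x, hx, hxm⟩ := hCcomp.exists_isMaxOn hne f.continuous.continuousOn
    obtain ⟨y, hy, hym⟩ := hCcomp.exists_isMinOn hne f.continuous.continuousOn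
    have hxm' : ∀ z ∈ C, f z ≤ f x := fun z hz => hxm hz
    have hym' : ∀ z ∈ C, f y ≤ f z := fun z hz => hym hz
    have hinj : ∀ a b : EuclideanSpace ℝ (Fin 1), f a = f b → a = b := by
      intro a b hab
      ext i
      rw [Subsingleton.elim i 0]
      exact hab
    have hseg : ∀ z, f y ≤ f z → f z ≤ f x → z ∈ C := by
      intro z hz1 hz2
      have : f z ∈ segment ℝ (f y) (f x) := by
        rw [segment_eq_Icc (hz1.trans hz2)]
        exact ⟨hz1, hz2⟩
      obtain ⟨a, b, ha, hb, hab, e⟩ := this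
      have : a • y + b • x = z := hinj _ _ (by rw [← e]; simp)
      rw [← this]
      exact hCconv hy hx ha hb hab
    have hs1 : minkAsym C ≤ 1 := by
      apply hlp_circ_le zero_le_one (x + y)
      intro z hz
      rw [one_smul]
      refine ⟨z - (x + y), ?_, by simp⟩
      show -(z - (x + y)) ∈ C
      apply hseg
      · have := hxm' z hz
        simp only [map_neg, map_sub, map_add]
        linarith
      · have := hym' z hz
        simp only [map_neg, map_sub, map_add]
        linarith
    have hs0 : 0 ≤ minkAsym C := hlp_circ_nonneg _ _
    have hneg : ∀ z ∈ C, -z ∈ C := by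
      intro z hz
      obtain ⟨w, hw, e⟩ := hMC.1 hz
      have hw' : -w ∈ C := hw
      have := hCconv.smul_mem_of_zero_mem h0C hw' ⟨hs0, hs1⟩
      rw [← e]
      simpa using this
    refine hlp_bal_of h0 f ?_ hx hy hxm' hym' ?_
    · intro hf
      have := congrArg (fun g => g (EuclideanSpace.single 0 1)) hf
      simp [f] at this
    · have a1 := hxm' _ (hneg y hy)
      have a2 := hym' _ (hneg x hx)
      rw [map_neg] at a1 a2
      linarith
  · let h : EuclideanSpace ℝ (Fin n) → ℝ := fun v => sSup ((fun z => inner ℝ v z) '' C)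
    have hcont : Continuous h := by
      apply hCcomp.continuous_sSup (f := fun v z => inner ℝ v z)
      show Continuous (fun p : EuclideanSpace ℝ (Fin n) × EuclideanSpace ℝ (Fin n) =>
        inner ℝ p.1 p.2)
      exact continuous_inner
    have hmax : ∀ v, ∃ x ∈ C, h v = inner ℝ v x ∧ ∀ z ∈ C, inner ℝ v z ≤ inner ℝ v x := by
      intro v
      have hc : ContinuousOn (fun z => inner ℝ v z) C := by fun_prop
      obtain ⟨x, hx, e, hm⟩ := hCcomp.exists_sSup_image_eq_and_ge hne hc
      exact ⟨x, hx, e, hm⟩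
    have hrank : 1 < Module.rank ℝ (EuclideanSpace ℝ (Fin n)) := by
      rw [← Module.finrank_eq_rank, finrank_euclideanSpace_fin]
      exact_mod_cast hn
    have hpre := isPreconnected_sphere hrank (0 : EuclideanSpace ℝ (Fin n)) 1
    let v0 : EuclideanSpace ℝ (Fin n) := EuclideanSpace.single ⟨0, by omega⟩ 1
    have hv0 : v0 ∈ Metric.sphere (0 : EuclideanSpace ℝ (Fin n)) 1 := by simp [v0]
    have hv0' : -v0 ∈ Metric.sphere (0 : EuclideanSpace ℝ (Fin n)) 1 := by simp [v0]
    have hgc : ContinuousOn (fun v => h v - h (-v))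
        (Metric.sphere (0 : EuclideanSpace ℝ (Fin n)) 1) := by fun_prop
    obtain ⟨v, hv, hv2⟩ : ∃ v ∈ Metric.sphere (0 : EuclideanSpace ℝ (Fin n)) 1,
        h v - h (-v) = 0 := by
      rcases le_total (h v0 - h (-v0)) 0 with hle | hle
      · have := hpre.intermediate_value hv0 hv0' hgc
        exact this ⟨hle, by simp only [neg_neg]; linarith⟩
      · have := hpre.intermediate_value hv0' hv0 hgc
        exact this ⟨by simp only [neg_neg]; linarith, hle⟩
    obtain ⟨x, hx, ex, hxm⟩ := hmax v
    obtain ⟨y, hy, ey, hym⟩ := hmax (-v)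
    simp only [inner_neg_left] at ey hym
    refine hlp_bal_of h0 (innerSL ℝ v) ?_ hx hy ?_ ?_ ?_
    · intro hf
      have := congrArg (fun g => g v) hf
      simp at this
      simp [this] at hv
    · simpa using hxm
    · simpa using hym
    · simp only [innerSL_apply_apply]
      linarith

/-- For a Minkowski-centered gauge `C`, the symmetrization `C_MAX = conv(C ∪ -C)` is a
completion of `C` with respect to `D_MAX`, with circumradius `R(C_MAX,C) = s(C)` maximal
among all completions of `C`. -/
theorem CMAX_completion_maximal {n : ℕ} (C : Set (EuclideanSpace ℝ (Fin n)))
    (hCconv : Convex ℝ C) (hCcomp : IsCompact C) (h0 : 0 ∈ interior C)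
    (hMC : MinkowskiCentered C) :
    IsCompletion (fun K => DMAX K C) C (symMAX C) ∧
      circumradius (symMAX C) C = minkAsym C ∧
      ∀ Kstar : Set (EuclideanSpace ℝ (Fin n)),
        IsCompletion (fun K => DMAX K C) C Kstar → circumradius Kstar C ≤ minkAsym C := by
  obtain ⟨f, m, hm, hfm, x, hx, y, hy, efx, efy⟩ := hlp_bal C hCconv hCcomp h0 hMC
  have h0C : (0 : EuclideanSpace ℝ (Fin n)) ∈ C := interior_subset h0
  have hne : C.Nonempty := ⟨0, h0C⟩
  have hMcomp := hlp_symMAX_compact hCconv hCcomp h0C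
  have hge2 : ∀ K : Set (EuclideanSpace ℝ (Fin n)), IsCompact K → C ⊆ K → 2 ≤ DMAX K C := by
    intro K hK hCK
    have := hlp_DMAX_ge h0 hK f hm hfm (hCK hx) (hCK hy)
    rw [efx, efy, show (m - -m) / m = 2 by field_simp; ring] at this
    exact this
  have hDC : DMAX C C = 2 :=
    le_antisymm (hlp_DMAX_le (hlp_sub_symMAX C)) (hge2 C hCcomp Subset.rfl)
  have hDM : DMAX (symMAX C) C = 2 :=
    le_antisymm (hlp_DMAX_le Subset.rfl) (hge2 _ hMcomp (hlp_sub_symMAX C))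
  have hs0 : 0 ≤ minkAsym C := hlp_circ_nonneg _ _
  have hsub : ∀ z ∈ C, ∃ w ∈ C, z = -(minkAsym C • w) := by
    intro z hz
    obtain ⟨w, hw, e⟩ := hMC.1 hz
    exact ⟨-w, hw, by rw [← e]; simp⟩
  have hs1 : 1 ≤ minkAsym C := by
    obtain ⟨w, hw, e⟩ := hsub x hx
    have e' := congrArg f e
    rw [map_neg, map_smul, smul_eq_mul, efx] at e'
    have b := mul_le_mul_of_nonneg_left (abs_le.1 (hfm w hw)).1 hs0
    by_contra! hcon
    nlinarith
  refine ⟨⟨hlp_sub_symMAX C, hlp_symMAX_convex C, hMcomp, ?_, hDM.trans hDC.symm⟩, ?_, ?_⟩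
  · intro K' _ hK'c hK'
    obtain ⟨p, hp, hpM⟩ := exists_of_ssubset hK'
    obtain ⟨g, u, hg, hu⟩ := geometric_hahn_banach_closed_point (hlp_symMAX_convex C)
      hMcomp.isClosed hpM
    obtain ⟨q, hq, hqm⟩ := hMcomp.exists_isMaxOn ⟨0, hlp_sub_symMAX C h0C⟩ g.continuous.continuousOn
    have hqm' : ∀ z ∈ symMAX C, g z ≤ g q := fun z hz => hqm hz
    have hgp : 0 < g p := by
      have := hg 0 (hlp_sub_symMAX C h0C)
      rw [map_zero] at this
      linarith
    obtain ⟨z, hz, hz0⟩ := hlp_pos h0 g hgp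
    have hq0 : 0 < g q := hz0.trans_le (hqm' z (hlp_sub_symMAX C hz))
    have hb : ∀ z ∈ C, |g z| ≤ g q := by
      intro z hz
      have a1 := hqm' _ (hlp_sub_symMAX C hz)
      have a2 := hqm' _ (hlp_symMAX_neg C (hlp_sub_symMAX C hz))
      rw [map_neg] at a2
      exact abs_le.2 ⟨by linarith, a1⟩
    have key := hlp_DMAX_ge h0 hK'c g hq0 hb hp (hK'.1 (hlp_symMAX_neg C hq))
    show DMAX (symMAX C) C < DMAX K' C
    rw [hDM]
    refine lt_of_lt_of_le ?_ key
    rw [lt_div_iff₀ hq0, map_neg]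
    have := hg q hq
    linarith
  · apply le_antisymm
    · apply hlp_circ_le hs0 0
      rw [zero_vadd]
      apply convexHull_min
      · rintro z (hz | hz)
        · refine ⟨(minkAsym C)⁻¹ • z, ?_, ?_⟩
          · exact hCconv.smul_mem_of_zero_mem h0C hz ⟨by positivity, inv_le_one_of_one_le₀ hs1⟩
          · exact smul_inv_smul₀ (by positivity) z
        · obtain ⟨w, hw, e⟩ := hsub (-z) hz
          exact ⟨w, hw, (neg_injective e).symm⟩
      · exact hCconv.smul _
    · apply le_csInf
      · exact hlp_absorb hMcomp h0
      · rintro ρ ⟨hρ, t, ht⟩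
        apply hlp_circ_le hρ (-t)
        intro z hz
        obtain ⟨_, ⟨w, hw, rfl⟩, e⟩ := ht (hlp_neg_sub_symMAX C (by simpa using hz : -z ∈ -C))
        refine ⟨ρ • (-w), ⟨-w, by simpa using hw, rfl⟩, ?_⟩
        simp only [vadd_eq_add] at e ⊢
        rw [← neg_neg z, ← e, smul_neg, neg_add]
  · rintro K ⟨hCK, _, hKc, _, hDK⟩
    have hDK2 : DMAX K C = 2 := Eq.trans hDK hDC
    apply hlp_circ_le hs0 0
    rw [zero_vadd]
    intro p hp
    by_contra hps
    obtain ⟨g, u, hg, hu⟩ := geometric_hahn_banach_closed_point (hCconv.smul (minkAsym C))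
      (hCcomp.smul (minkAsym C)).isClosed hps
    obtain ⟨a, ha, ham⟩ := hCcomp.exists_isMaxOn hne g.continuous.continuousOn
    obtain ⟨b, hb, hbm⟩ := hCcomp.exists_isMinOn hne g.continuous.continuousOn
    have ham' : ∀ z ∈ C, g z ≤ g a := fun z hz => ham hz
    have hbm' : ∀ z ∈ C, g b ≤ g z := fun z hz => hbm hz
    have hga : minkAsym C * g a < g p := by
      have := hg _ (smul_mem_smul_set ha)
      rw [map_smul, smul_eq_mul] at this
      linarith
    have ha0 : 0 ≤ g a := by simpa using ham' 0 h0C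
    have hgp : 0 < g p := lt_of_le_of_lt (by positivity) hga
    obtain ⟨z, hz, hz0⟩ := hlp_pos h0 g hgp
    have ha1 : 0 < g a := hz0.trans_le (ham' z hz)
    have hA : -g b ≤ minkAsym C * g a := by
      obtain ⟨w, hw, e⟩ := hsub b hb
      have e' := congrArg g e
      rw [map_neg, map_smul, smul_eq_mul] at e'
      have := mul_le_mul_of_nonneg_left (ham' w hw) hs0
      linarith
    have hB : g a ≤ minkAsym C * (-g b) := by
      obtain ⟨w, hw, e⟩ := hsub a ha
      have e' := congrArg g e
      rw [map_neg, map_smul, smul_eq_mul] at e'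
      have := mul_le_mul_of_nonneg_left (hbm' w hw) hs0
      linarith
    have hM0 : 0 < max (g a) (-g b) := lt_max_of_lt_left ha1
    have key := hlp_DMAX_ge h0 hKc g hM0 (fun z hz => abs_le.2
      ⟨by have := hbm' z hz; have := le_max_right (g a) (-g b); linarith,
        (ham' z hz).trans (le_max_left _ _)⟩) hp (hCK hb)
    rw [hDK2, div_le_iff₀ hM0] at key
    rcases le_total (g a) (-g b) with hc | hc
    · rw [max_eq_right hc] at key
      linarith
    · rw [max_eq_left hc] at key
      have hspos : 0 < minkAsym C := by linarith
      nlinarith [mul_nonneg (sq_nonneg (minkAsym C - 1)) ha1.le]
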